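/- arXiv:2204.01362 — 2 statements merged into one kernel-verified Lean document; each statement's English description precedes it below -/
import Mathlib

section
/- Let G be a hom-set strong small category and let S be a hom-set-strongly G-graded ring (in particular object unital). Then, for each of the four chain conditions (left artinian, right artinian, left noetherian, right noetherian), S satisfies the chain condition if and only if G_0 is finite and for every a ∈ G_0 the ring S_{G(a)} satisfies the same chain condition. -/
open CategoryTheory

namespace ChainPaper

section NonUnital

variable {S : Type*} [NonUnitalRing S]

/-- The additive subgroup `e S f = {e * s * f | s ∈ S}` of a non-unital ring `S`. -/
def corner (e f : S) : AddSubgroup S :=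
  ((AddMonoidHom.mulLeft e).comp (AddMonoidHom.mulRight f)).range

/-- The additive subgroup `S e = {s * e | s ∈ S}`. -/
def rightMulRange (e : S) : AddSubgroup S := (AddMonoidHom.mulRight e).range

/-- The additive subgroup `e S = {e * s | s ∈ S}`. -/
def leftMulRange (e : S) : AddSubgroup S := (AddMonoidHom.mulLeft e).range

/-- The product of two additive subgroups of a ring: the additive subgroup generated by
all products `a * b` with `a ∈ A`, `b ∈ B`. -/
def sMul (A B : AddSubgroup S) : AddSubgroup S :=
  AddSubgroup.closure {x | ∃ a ∈ A, ∃ b ∈ B, x = a * b}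

/-- `I` is a left ideal of the (possibly non-unital) subring whose carrier is
the additive subgroup `C` (closed under multiplication). -/
def IsLeftIdealIn (C I : AddSubgroup S) : Prop :=
  I ≤ C ∧ ∀ s ∈ C, ∀ x ∈ I, s * x ∈ I

def IsRightIdealIn (C I : AddSubgroup S) : Prop :=
  I ≤ C ∧ ∀ s ∈ C, ∀ x ∈ I, x * s ∈ I

/-- `M` is a left `C`-submodule of `H` (both viewed inside the ambient ring `S`,
with `C` acting by left multiplication). -/
def IsLeftSubmoduleIn (C H M : AddSubgroup S) : Prop :=
  M ≤ H ∧ ∀ s ∈ C, ∀ x ∈ M, s * x ∈ M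

def IsRightSubmoduleIn (C H M : AddSubgroup S) : Prop :=
  M ≤ H ∧ ∀ s ∈ C, ∀ x ∈ M, x * s ∈ M

/-- The descending chain condition on the subcollection of additive subgroups of `S`
cut out by the predicate `P`. -/
def DCCOn (P : AddSubgroup S → Prop) : Prop :=
  ∀ f : ℕ → AddSubgroup S, (∀ n, P (f n)) → (∀ n, f (n + 1) ≤ f n) →
    ∃ n, ∀ m, n ≤ m → f m = f n

/-- The ascending chain condition on the subcollection of additive subgroups of `S`
cut out by the predicate `P`. -/
def ACCOn (P : AddSubgroup S → Prop) : Prop :=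
  ∀ f : ℕ → AddSubgroup S, (∀ n, P (f n)) → (∀ n, f n ≤ f (n + 1)) →
    ∃ n, ∀ m, n ≤ m → f m = f n

def LeftArtinianOn (C : AddSubgroup S) : Prop := DCCOn (IsLeftIdealIn C)
def RightArtinianOn (C : AddSubgroup S) : Prop := DCCOn (IsRightIdealIn C)
def LeftNoetherianOn (C : AddSubgroup S) : Prop := ACCOn (IsLeftIdealIn C)
def RightNoetherianOn (C : AddSubgroup S) : Prop := ACCOn (IsRightIdealIn C)

end NonUnital

/-- A possibly non-unital ring is left artinian if its poset of left ideals
satisfies the descending chain condition. -/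
def IsLeftArtinian (S : Type*) [NonUnitalRing S] : Prop := LeftArtinianOn (⊤ : AddSubgroup S)
def IsRightArtinian (S : Type*) [NonUnitalRing S] : Prop := RightArtinianOn (⊤ : AddSubgroup S)
def IsLeftNoetherian (S : Type*) [NonUnitalRing S] : Prop := LeftNoetherianOn (⊤ : AddSubgroup S)
def IsRightNoetherian (S : Type*) [NonUnitalRing S] : Prop := RightNoetherianOn (⊤ : AddSubgroup S)

section NonUnital2

variable {S : Type*} [NonUnitalRing S]

/-- `{e i}_{i ∈ ι}` is a complete set of idempotents for `S`: the `e i` are nonzero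
pairwise orthogonal idempotents and `S = ⊕ᵢ S eᵢ = ⊕ᵢ eᵢ S` as internal direct sums of
additive subgroups. -/
structure IsCompleteIdempotents {ι : Type*} (e : ι → S) : Prop where
  ne_zero : ∀ i, e i ≠ 0
  idem : ∀ i, e i * e i = e i
  orthogonal : ∀ i j, i ≠ j → e i * e j = 0
  indep_right : iSupIndep fun i => rightMulRange (e i)
  span_right : (⨆ i, rightMulRange (e i)) = ⊤
  indep_left : iSupIndep fun i => leftMulRange (e i)
  span_left : (⨆ i, leftMulRange (e i)) = ⊤

/-- A complete set of idempotents is strong if for all `p q`, whenever one of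
`eₚ S e_q` and `e_q S eₚ` is nonzero, then the other is nonzero and `eₚ ∈ (eₚ S e_q)(e_q S eₚ)`. -/
def IsStrongIdempotents {ι : Type*} (e : ι → S) : Prop :=
  ∀ p q : ι,
    (corner (e p) (e q) ≠ ⊥ ∨ corner (e q) (e p) ≠ ⊥) →
      corner (e p) (e q) ≠ ⊥ ∧ corner (e q) (e p) ≠ ⊥ ∧
        e p ∈ sMul (corner (e p) (e q)) (corner (e q) (e p))

/-- `H` is finitely generated as a left module over `C` (inside the ambient ring `S`,
`C` acting by left multiplication). -/
def IsFGLeftModuleIn (C H : AddSubgroup S) : Prop :=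
  ∃ F : Finset S, ↑F ⊆ (H : Set S) ∧
    ∀ x ∈ H, x ∈ sInf {M : AddSubgroup S | ↑F ⊆ (M : Set S) ∧ ∀ s ∈ C, ∀ y ∈ M, s * y ∈ M}

def IsFGRightModuleIn (C H : AddSubgroup S) : Prop :=
  ∃ F : Finset S, ↑F ⊆ (H : Set S) ∧
    ∀ x ∈ H, x ∈ sInf {M : AddSubgroup S | ↑F ⊆ (M : Set S) ∧ ∀ s ∈ C, ∀ y ∈ M, y * s ∈ M}

end NonUnital2

/-- A small category `G` is hom-set strong if for all objects `x y`, whenever one of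
`G(x,y)` and `G(y,x)` is nonempty (here `G(x,y)` denotes the set of morphisms `y → x`),
then the other is nonempty and `𝟙 x ∈ G(x,y)G(y,x)`. -/
def HomSetStrong (G : Type*) [Category G] : Prop :=
  ∀ x y : G, (Nonempty (y ⟶ x) ∨ Nonempty (x ⟶ y)) →
    Nonempty (y ⟶ x) ∧ Nonempty (x ⟶ y) ∧ ∃ (g : y ⟶ x) (h : x ⟶ y), h ≫ g = 𝟙 x

/-- An object unital grading of the (possibly non-unital) ring `S` by the small category `G`:
`S = ⊕_{g ∈ G₁} S_g` with `S_g S_h ⊆ S_{g ∘ h}` for composable morphisms, `S_g S_h = 0` for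
non-composable ones, and each `S_a` (`a ∈ G₀`) is unital and nonzero with identity `one a`
acting as claimed. The component at a morphism `g : a ⟶ b` (in Mathlib's arrow direction) is
`comp g`, and products follow the paper's convention `S_g S_h ⊆ S_{gh}` where `gh` denotes
`h ≫ g`. -/
structure ObjectUnitalGrading (G : Type*) [Category G] (S : Type*) [NonUnitalRing S] where
  comp : ∀ {a b : G}, (a ⟶ b) → AddSubgroup S
  indep : iSupIndep fun p : Σ a : G, Σ b : G, a ⟶ b => comp p.2.2
  span : (⨆ p : Σ a : G, Σ b : G, a ⟶ b, comp p.2.2) = ⊤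
  mul_mem : ∀ {a b c : G} (g : b ⟶ c) (h : a ⟶ b) {x y : S},
    x ∈ comp g → y ∈ comp h → x * y ∈ comp (h ≫ g)
  mul_eq_zero : ∀ {a b a' b' : G} (g : a ⟶ b) (h : a' ⟶ b') {x y : S},
    x ∈ comp g → y ∈ comp h → b' ≠ a → x * y = 0
  one : G → S
  one_mem : ∀ a : G, one a ∈ comp (𝟙 a)
  one_ne_zero : ∀ a : G, one a ≠ 0
  one_mul_mem : ∀ {a b : G} (g : a ⟶ b), ∀ x ∈ comp g, one b * x = x
  mul_one_mem : ∀ {a b : G} (g : a ⟶ b), ∀ x ∈ comp g, x * one a = x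

namespace ObjectUnitalGrading

variable {G : Type*} [Category G] {S : Type*} [NonUnitalRing S]

/-- `E.hom a b = S_{G(b,a)}`, the sum of the components of all morphisms `a ⟶ b`. -/
def hom (E : ObjectUnitalGrading G S) (a b : G) : AddSubgroup S :=
  ⨆ g : a ⟶ b, E.comp g

/-- The grading is strong: `S_g S_h = S_{gh}` for all composable `g, h`. -/
def IsStronglyGraded (E : ObjectUnitalGrading G S) : Prop :=
  ∀ {a b c : G} (g : b ⟶ c) (h : a ⟶ b), sMul (E.comp g) (E.comp h) = E.comp (h ≫ g)

/-- The grading is hom-set strong: for all objects `p q`, whenever one of `S_{G(p,q)}`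
and `S_{G(q,p)}` is nonzero, the other is nonzero and `1_{S_p} ∈ S_{G(p,q)} S_{G(q,p)}`. -/
def IsHomSetStronglyGraded (E : ObjectUnitalGrading G S) : Prop :=
  ∀ p q : G, (E.hom q p ≠ ⊥ ∨ E.hom p q ≠ ⊥) →
    E.hom q p ≠ ⊥ ∧ E.hom p q ≠ ⊥ ∧ E.one p ∈ sMul (E.hom q p) (E.hom p q)

end ObjectUnitalGrading

/-- A group `H` is polycyclic-by-finite if it has a finite length subnormal series with
each factor a finite group or an infinite cyclic group. -/
def IsPolycyclicByFinite (H : Type*) [Group H] : Prop :=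
  ∃ (n : ℕ) (c : Fin (n + 1) → Subgroup H),
    c 0 = ⊥ ∧ c (Fin.last n) = ⊤ ∧
      ∀ i : Fin n,
        c i.castSucc ≤ c i.succ ∧
        ∃ _ : ((c i.castSucc).subgroupOf (c i.succ)).Normal,
          Finite ((c i.succ) ⧸ (c i.castSucc).subgroupOf (c i.succ)) ∨
            (Infinite ((c i.succ) ⧸ (c i.castSucc).subgroupOf (c i.succ)) ∧
              IsCyclic ((c i.succ) ⧸ (c i.castSucc).subgroupOf (c i.succ)))

/-- Data exhibiting the non-unital ring `A` as the category algebra `T[G]`: an additive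
isomorphism with the free `T`-module on the set of morphisms of `G`, matching the
multiplication `(t g)(u h) = (t u)(gh)` for composable `g, h` (where `gh = h ≫ g`) and
`(t g)(u h) = 0` otherwise. -/
structure CategoryAlgebraIso (T : Type*) [Ring T] (G : Type*) [Category G]
    (A : Type*) [NonUnitalRing A] where
  equiv : ((Σ a : G, Σ b : G, a ⟶ b) →₀ T) ≃+ A
  mul_single_comp : ∀ {a b c : G} (g : b ⟶ c) (h : a ⟶ b) (t u : T),
    equiv (Finsupp.single ⟨b, c, g⟩ t) * equiv (Finsupp.single ⟨a, b, h⟩ u) =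
      equiv (Finsupp.single ⟨a, c, h ≫ g⟩ (t * u))
  mul_single_ne : ∀ {a b a' b' : G} (g : a ⟶ b) (h : a' ⟶ b') (t u : T), b' ≠ a →
    equiv (Finsupp.single ⟨a, b, g⟩ t) * equiv (Finsupp.single ⟨a', b', h⟩ u) = 0

/-- Data exhibiting the non-unital ring `A` as the skew category algebra `R *_α G`: an
additive isomorphism with the direct sum `⊕_{g ∈ G₁} R_{c(g)}`, matching the multiplication
`(r g)(r' h) = (r · α_g(r')) (gh)` for composable `g, h` (where `gh = h ≫ g`) and
`(r g)(r' h) = 0` otherwise. -/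
structure SkewCategoryAlgebraIso (G : Type*) [Category G]
    [DecidableEq (Σ a : G, Σ b : G, a ⟶ b)]
    (R : G → Type*) [∀ a, Ring (R a)]
    (α : ∀ ⦃a b : G⦄, (a ⟶ b) → (R a →+* R b))
    (A : Type*) [NonUnitalRing A] where
  equiv : (Π₀ p : Σ a : G, Σ b : G, a ⟶ b, R p.2.1) ≃+ A
  mul_single_comp : ∀ {a b c : G} (g : b ⟶ c) (h : a ⟶ b) (r : R c) (r' : R b),
    equiv (DFinsupp.single ⟨b, c, g⟩ r) * equiv (DFinsupp.single ⟨a, b, h⟩ r') =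
      equiv (DFinsupp.single ⟨a, c, h ≫ g⟩ (r * α g r'))
  mul_single_ne : ∀ {a b a' b' : G} (g : a ⟶ b) (h : a' ⟶ b') (r : R b) (r' : R b'),
    b' ≠ a →
      equiv (DFinsupp.single ⟨a, b, g⟩ r) * equiv (DFinsupp.single ⟨a', b', h⟩ r') = 0


section ChainConditions

variable {S T : Type*} [NonUnitalRing S] [NonUnitalRing T]

theorem dccOn_iff_wellFoundedLT {P : AddSubgroup S → Prop} :
    DCCOn P ↔ WellFoundedLT {I // P I} := by
  refine ⟨fun h => ?_, fun h f hf hmono => ?_⟩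
  · have : WellFoundedGT {I // P I}ᵒᵈ := by
      refine wellFoundedGT_iff_monotone_chain_condition.2 fun a => ?_
      obtain ⟨n, hn⟩ := h (fun n => (OrderDual.ofDual (a n)).1)
        (fun n => (OrderDual.ofDual (a n)).2) (fun n => a.mono n.le_succ)
      exact ⟨n, fun m hm => Subtype.ext (hn m hm).symm⟩
    exact ⟨this.wf⟩
  · obtain ⟨n, hn⟩ := WellFoundedLT.antitone_chain_condition
      (f := fun n => (⟨f n, hf n⟩ : {I // P I})) (antitone_nat_of_succ_le hmono)
    exact ⟨n, fun m hm => (congrArg Subtype.val (hn m hm)).symm⟩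

theorem accOn_iff_wellFoundedGT {P : AddSubgroup S → Prop} :
    ACCOn P ↔ WellFoundedGT {I // P I} := by
  refine ⟨fun h => wellFoundedGT_iff_monotone_chain_condition.2 fun a => ?_,
    fun h f hf hmono => ?_⟩
  · obtain ⟨n, hn⟩ := h (fun n => (a n).1) (fun n => (a n).2) (fun n => a.mono n.le_succ)
    exact ⟨n, fun m hm => Subtype.ext (hn m hm).symm⟩
  · obtain ⟨n, hn⟩ := WellFoundedGT.monotone_chain_condition
      (⟨fun n => (⟨f n, hf n⟩ : {I // P I}), monotone_nat_of_le_succ hmono⟩ : ℕ →o _)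
    exact ⟨n, fun m hm => (congrArg Subtype.val (hn m hm)).symm⟩

/-- The order isomorphism between the additive subgroups of `S` and those of `Sᵐᵒᵖ`. -/
def opSubgroup : AddSubgroup S ≃o AddSubgroup Sᵐᵒᵖ :=
  (MulOpposite.opAddEquiv : S ≃+ Sᵐᵒᵖ).mapAddSubgroup

theorem op_mem_opSubgroup {I : AddSubgroup S} {x : S} :
    MulOpposite.op x ∈ opSubgroup I ↔ x ∈ I := by
  refine ⟨?_, fun h => ⟨x, h, rfl⟩⟩
  rintro ⟨y, hy, hxy⟩
  exact MulOpposite.op_injective hxy ▸ hy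

theorem isLeftIdealIn_opSubgroup {C I : AddSubgroup S} :
    IsLeftIdealIn (opSubgroup C) (opSubgroup I) ↔ IsRightIdealIn C I := by
  refine and_congr opSubgroup.le_iff_le ⟨fun h s hs x hx => ?_, ?_⟩
  · exact op_mem_opSubgroup.1
      (h _ (op_mem_opSubgroup.2 hs) _ (op_mem_opSubgroup.2 hx))
  · rintro h _ ⟨s, hs, rfl⟩ _ ⟨x, hx, rfl⟩
    exact op_mem_opSubgroup.2 (h s hs x hx)

/-- Right ideals of `C` correspond to left ideals of the opposite of `C`. -/
def rightIdealsOrderIso (C : AddSubgroup S) :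
    {I // IsRightIdealIn C I} ≃o {I // IsLeftIdealIn (opSubgroup C) I} where
  toEquiv := opSubgroup.toEquiv.subtypeEquiv fun _ => isLeftIdealIn_opSubgroup.symm
  map_rel_iff' := opSubgroup.le_iff_le

theorem leftArtinianOn_opSubgroup {C : AddSubgroup S} :
    LeftArtinianOn (opSubgroup C) ↔ RightArtinianOn C := by
  rw [LeftArtinianOn, RightArtinianOn, dccOn_iff_wellFoundedLT, dccOn_iff_wellFoundedLT]
  refine ⟨fun _ => ?_, fun _ => ?_⟩
  · exact (rightIdealsOrderIso C).strictMono.wellFoundedLT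
  · exact (rightIdealsOrderIso C).symm.strictMono.wellFoundedLT

theorem leftNoetherianOn_opSubgroup {C : AddSubgroup S} :
    LeftNoetherianOn (opSubgroup C) ↔ RightNoetherianOn C := by
  rw [LeftNoetherianOn, RightNoetherianOn, accOn_iff_wellFoundedGT, accOn_iff_wellFoundedGT]
  refine ⟨fun _ => ?_, fun _ => ?_⟩
  · exact (rightIdealsOrderIso C).strictMono.wellFoundedGT
  · exact (rightIdealsOrderIso C).symm.strictMono.wellFoundedGT

theorem isLeftArtinian_op : IsLeftArtinian Sᵐᵒᵖ ↔ IsRightArtinian S := by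
  rw [IsRightArtinian, ← leftArtinianOn_opSubgroup, opSubgroup.map_top, IsLeftArtinian]

theorem isLeftNoetherian_op : IsLeftNoetherian Sᵐᵒᵖ ↔ IsRightNoetherian S := by
  rw [IsRightNoetherian, ← leftNoetherianOn_opSubgroup, opSubgroup.map_top, IsLeftNoetherian]

theorem opSubgroup_corner (e f : S) :
    opSubgroup (corner e f) = corner (MulOpposite.op f) (MulOpposite.op e) := by
  ext x
  constructor
  · rintro ⟨_, ⟨y, rfl⟩, rfl⟩
    exact ⟨MulOpposite.op y, MulOpposite.unop_injective (by simp [mul_assoc])⟩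
  · rintro ⟨y, rfl⟩
    exact ⟨_, ⟨y.unop, rfl⟩, MulOpposite.unop_injective (by simp [mul_assoc])⟩

theorem finite_of_wellFoundedGT_set {ι : Type*} [WellFoundedGT (Set ι)] : Finite ι := by
  by_contra h
  rw [not_finite_iff_infinite] at h
  have hmono : StrictMono fun n : ℕ => Infinite.natEmbedding ι '' Set.Iio n :=
    (Infinite.natEmbedding ι).injective.image_strictMono.comp
      fun _ _ => Set.Iio_ssubset_Iio
  have := hmono.wellFoundedGT
  obtain ⟨n, hn⟩ := WellFoundedGT.monotone_chain_condition (OrderHom.id (α := ℕ))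
  exact absurd (hn (n + 1) n.le_succ) n.lt_succ_self.ne

theorem finite_of_wellFoundedLT_set {ι : Type*} [WellFoundedLT (Set ι)] : Finite ι := by
  have hanti : StrictAnti (compl : Set ι → Set ι) := compl_strictAnti (Set ι)
  have := hanti.wellFoundedGT
  exact finite_of_wellFoundedGT_set

end ChainConditions

theorem mem_corner_iff {S : Type*} [NonUnitalRing S] {e f x : S} (he : e * e = e)
    (hf : f * f = f) : x ∈ corner e f ↔ e * x = x ∧ x * f = x := by
  constructor
  · rintro ⟨y, rfl⟩
    simp only [AddMonoidHom.comp_apply, AddMonoidHom.coe_mulLeft, AddMonoidHom.coe_mulRight]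
    exact ⟨by rw [← mul_assoc, he], by rw [mul_assoc, mul_assoc, hf]⟩
  · rintro ⟨h₁, h₂⟩
    exact ⟨x, by simp [h₁, h₂]⟩

/-- Orthogonal idempotents `e i`, complete when there are finitely many of them, such that
for all `p q` finitely many elements `u` suffice to detect the vanishing of `e p * y * e q`
through the corner elements `e p * (y * u) * e p`. -/
structure IsLeftSeparating {S : Type*} [NonUnitalRing S] {ι : Type*} (e : ι → S) : Prop where
  ne_zero : ∀ i, e i ≠ 0
  idem : ∀ i, IsIdempotentElem (e i)
  orthogonal : ∀ i j, i ≠ j → e i * e j = 0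
  sum_mul : ∀ [Fintype ι] (x : S), ∑ i, e i * x = x
  mul_sum : ∀ [Fintype ι] (x : S), ∑ i, x * e i = x
  separating : ∀ p q, ∃ T : Finset S, ∀ y,
    (∀ u ∈ T, e p * (y * u) * e p = 0) → e p * y * e q = 0

namespace IsLeftSeparating

variable {S : Type*} [NonUnitalRing S] {ι : Type*} {e : ι → S}

/-- The left ideal annihilated on the right by the `e i` with `i ∉ A`. -/
def supportedIdeal (e : ι → S) (A : Set ι) : {I // IsLeftIdealIn (⊤ : AddSubgroup S) I} where
  val :=
    { carrier := {x | ∀ i ∉ A, x * e i = 0}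
      zero_mem' := by simp
      add_mem' := fun hx hy i hi => by rw [add_mul, hx i hi, hy i hi, add_zero]
      neg_mem' := fun hx i hi => by rw [neg_mul, hx i hi, neg_zero] }
  property := ⟨le_top, fun s _ x hx i hi => by rw [mul_assoc, hx i hi, mul_zero]⟩

theorem supportedIdeal_strictMono (h : IsLeftSeparating e) : StrictMono (supportedIdeal e) := by
  refine strictMono_of_le_iff_le fun A B => ⟨fun hAB x hx i hi => hx i fun hA => hi (hAB hA),
    fun hle i hi => ?_⟩
  by_contra hB
  have hmem : e i ∈ (supportedIdeal e A).1 := fun j hj =>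
    h.orthogonal i j fun hij => hj (hij ▸ hi)
  exact h.ne_zero i ((h.idem i).symm.trans (hle hmem i hB))

/-- The largest left ideal of `S` whose elements `x` satisfy `e * S * x ⊆ I`. -/
def coinducedIdeal (e : S) (I : AddSubgroup S) : {I // IsLeftIdealIn (⊤ : AddSubgroup S) I} where
  val :=
    { carrier := {x | ∀ s, e * s * x ∈ I}
      zero_mem' := by simp [I.zero_mem]
      add_mem' := fun hx hy s => by rw [mul_add]; exact I.add_mem (hx s) (hy s)
      neg_mem' := fun hx s => by rw [mul_neg]; exact I.neg_mem (hx s) }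
  property := ⟨le_top, fun s _ x hx t => by rw [← mul_assoc, mul_assoc e]; exact hx _⟩

theorem coinducedIdeal_strictMono {e : S} (he : e * e = e) :
    StrictMono fun I : {I // IsLeftIdealIn (corner e e) I} => coinducedIdeal e I.1 := by
  refine strictMono_of_le_iff_le fun I J => ⟨fun hIJ x hx s => hIJ (hx s), fun hle x hx => ?_⟩
  have hxe := ((mem_corner_iff he he).1 (I.2.1 hx)).1
  have hmem : x ∈ (coinducedIdeal e I.1).1 := fun s => by
    rw [← hxe, ← mul_assoc]
    exact I.2.2 _ ⟨s, by simp [mul_assoc]⟩ x hx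
  have := hle hmem e
  rwa [he, hxe] at this

/-- A left ideal of the ring `e S e`, seen as a left ideal of the corner inside `S`. -/
def cornerIdeal {e : S} (he : IsIdempotentElem e) (M : Submodule he.Corner he.Corner) :
    {I // IsLeftIdealIn (corner e e) I} where
  val :=
    { carrier := {x | ∃ c ∈ M, c.1 = x}
      zero_mem' := ⟨0, M.zero_mem, rfl⟩
      add_mem' := by
        rintro _ _ ⟨c, hc, rfl⟩ ⟨d, hd, rfl⟩
        exact ⟨c + d, M.add_mem hc hd, rfl⟩
      neg_mem' := by
        rintro _ ⟨c, hc, rfl⟩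
        exact ⟨-c, M.neg_mem hc, rfl⟩ }
  property := by
    constructor
    · rintro _ ⟨c, -, rfl⟩
      exact (mem_corner_iff he he).2 ((Subsemigroup.mem_corner_iff he).1 c.2)
    · rintro s hs _ ⟨c, hc, rfl⟩
      exact ⟨_, M.smul_mem ⟨s, (Subsemigroup.mem_corner_iff he).2 ((mem_corner_iff he he).1 hs)⟩ hc,
        rfl⟩

theorem cornerIdeal_strictMono {e : S} (he : IsIdempotentElem e) :
    StrictMono (cornerIdeal he) := by
  refine strictMono_of_le_iff_le fun M N => ⟨?_, fun hle c hc => ?_⟩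
  · rintro hMN _ ⟨c, hc, rfl⟩
    exact ⟨c, hMN hc, rfl⟩
  · obtain ⟨d, hd, hdc⟩ := hle ⟨c, hc, rfl⟩
    exact Subtype.ext hdc ▸ hd

/-- The tuple of corner elements `e * (x * u) * e` for `u ∈ T`. -/
def cornerTuple {e : S} (he : IsIdempotentElem e) (T : Finset S) (x : S) : T → he.Corner :=
  fun u => ⟨e * (x * u) * e, _, rfl⟩

/-- The image of a left ideal of `S` in a finite power of the ring `e S e`. -/
def tupleSubmodule {e : S} (he : IsIdempotentElem e) (T : Finset S)
    (I : {I // IsLeftIdealIn (⊤ : AddSubgroup S) I}) :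
    Submodule he.Corner (T → he.Corner) where
  carrier := {f | ∃ x ∈ I.1, f = cornerTuple he T x}
  zero_mem' := ⟨0, I.1.zero_mem, funext fun u => Subtype.ext <| by
    change (0 : S) = e * (0 * u) * e
    simp⟩
  add_mem' := by
    rintro _ _ ⟨x, hx, rfl⟩ ⟨y, hy, rfl⟩
    refine ⟨x + y, I.1.add_mem hx hy, funext fun u => Subtype.ext ?_⟩
    change e * (x * u) * e + e * (y * u) * e = e * ((x + y) * u) * e
    simp only [add_mul, mul_add]
  smul_mem' := by
    rintro c _ ⟨x, hx, rfl⟩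
    refine ⟨c.1 * (e * x), I.2.2 _ trivial _ (I.2.2 _ trivial _ hx),
      funext fun u => Subtype.ext ?_⟩
    change c.1 * (e * (x * u) * e) = e * (c.1 * (e * x) * u) * e
    have hc := ((Subsemigroup.mem_corner_iff he).1 c.2).1
    simp only [← mul_assoc, hc]

theorem exists_strictMono_pi [Finite ι] (h : IsLeftSeparating e) :
    ∃ (T : ι → Finset S) (F : {I // IsLeftIdealIn (⊤ : AddSubgroup S) I} →
      ∀ a, Submodule (IsIdempotentElem.Corner (h.idem a))
        (T a → IsIdempotentElem.Corner (h.idem a))), StrictMono F := by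
  classical
  have := Fintype.ofFinite ι
  choose T hT using h.separating
  refine ⟨fun a => Finset.univ.biUnion (T a), fun I a => tupleSubmodule (h.idem a) _ I,
    strictMono_of_le_iff_le fun I J => ⟨?_, fun hle x hx => ?_⟩⟩
  · rintro hIJ a _ ⟨x, hx, rfl⟩
    exact ⟨x, hIJ hx, rfl⟩
  · rw [← h.sum_mul x]
    refine J.1.sum_mem fun a _ => ?_
    obtain ⟨y, hy, hxy⟩ := hle a ⟨x, hx, rfl⟩
    have hq : ∀ q, e a * (x - y) * e q = 0 := fun q => hT a q _ fun u hu => by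
      have : e a * (x * u) * e a = e a * (y * u) * e a := congrArg Subtype.val
        (congrFun hxy ⟨u, Finset.mem_biUnion.2 ⟨q, Finset.mem_univ q, hu⟩⟩)
      rw [sub_mul, mul_sub, sub_mul, this, sub_self]
    have heq : e a * (x - y) = 0 := by
      rw [← h.mul_sum (e a * (x - y))]
      exact Finset.sum_eq_zero fun q _ => hq q
    rw [mul_sub, sub_eq_zero] at heq
    rw [heq]
    exact J.2.2 _ trivial _ hy

theorem isLeftArtinian_iff (h : IsLeftSeparating e) :
    IsLeftArtinian S ↔ Finite ι ∧ ∀ a, LeftArtinianOn (corner (e a) (e a)) := by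
  simp only [IsLeftArtinian, LeftArtinianOn, dccOn_iff_wellFoundedLT]
  refine ⟨fun _ => ⟨?_, fun a => (coinducedIdeal_strictMono (h.idem a)).wellFoundedLT⟩, ?_⟩
  · have := h.supportedIdeal_strictMono.wellFoundedLT
    exact finite_of_wellFoundedLT_set
  · rintro ⟨_, hC⟩
    have (a : ι) : IsArtinian (IsIdempotentElem.Corner (h.idem a))
        (IsIdempotentElem.Corner (h.idem a)) :=
      have := hC a
      (cornerIdeal_strictMono (h.idem a)).wellFoundedLT
    obtain ⟨T, F, hF⟩ := h.exists_strictMono_pi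
    have (a : ι) : WellFoundedLT (Submodule (IsIdempotentElem.Corner (h.idem a))
      (T a → IsIdempotentElem.Corner (h.idem a))) := inferInstance
    exact hF.wellFoundedLT

theorem isLeftNoetherian_iff (h : IsLeftSeparating e) :
    IsLeftNoetherian S ↔ Finite ι ∧ ∀ a, LeftNoetherianOn (corner (e a) (e a)) := by
  simp only [IsLeftNoetherian, LeftNoetherianOn, accOn_iff_wellFoundedGT]
  refine ⟨fun _ => ⟨?_, fun a => (coinducedIdeal_strictMono (h.idem a)).wellFoundedGT⟩, ?_⟩
  · have := h.supportedIdeal_strictMono.wellFoundedGT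
    exact finite_of_wellFoundedGT_set
  · rintro ⟨_, hC⟩
    have (a : ι) : IsNoetherian (IsIdempotentElem.Corner (h.idem a))
        (IsIdempotentElem.Corner (h.idem a)) :=
      have := hC a
      isNoetherian_mk (cornerIdeal_strictMono (h.idem a)).wellFoundedGT
    obtain ⟨T, F, hF⟩ := h.exists_strictMono_pi
    have (a : ι) : WellFoundedGT (Submodule (IsIdempotentElem.Corner (h.idem a))
      (T a → IsIdempotentElem.Corner (h.idem a))) := inferInstance
    have hdual : StrictMono fun I a => OrderDual.toDual (F (OrderDual.ofDual I) a) :=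
      fun _ _ h => hF h
    have := hdual.wellFoundedLT
    exact ⟨this.wf⟩

end IsLeftSeparating

section Separation

variable {S : Type*} [NonUnitalRing S]

theorem exists_finset_forall_mul_eq_zero {e f z : S} {B : AddSubgroup S}
    (he : e * e = e) (hf : f * f = f) (hz : z ∈ sMul (corner f e) B) :
    ∃ T : Finset S, ∀ y, (∀ u ∈ T, e * (y * u) * e = 0) → e * y * z = 0 := by
  classical
  induction hz using AddSubgroup.closure_induction with
  | mem z hz =>
    obtain ⟨u, hu, v, -, rfl⟩ := hz
    refine ⟨{u}, fun y hy => ?_⟩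
    have := hy u (Finset.mem_singleton_self u)
    rw [mul_assoc, mul_assoc, ((mem_corner_iff hf he).1 hu).2] at this
    rw [← mul_assoc, mul_assoc e, this, zero_mul]
  | zero => exact ⟨∅, fun y _ => mul_zero _⟩
  | add a b _ _ iha ihb =>
    obtain ⟨A, hA⟩ := iha
    obtain ⟨B, hB⟩ := ihb
    refine ⟨A ∪ B, fun y hy => ?_⟩
    rw [mul_add, hA y fun u hu => hy u (Finset.mem_union_left _ hu),
      hB y fun u hu => hy u (Finset.mem_union_right _ hu), add_zero]
  | neg a _ iha =>
    obtain ⟨A, hA⟩ := iha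
    exact ⟨A, fun y hy => by rw [mul_neg, hA y hy, neg_zero]⟩

theorem opSubgroup_sMul_le (A B : AddSubgroup S) :
    opSubgroup (sMul A B) ≤ sMul (opSubgroup B) (opSubgroup A) := by
  rintro _ ⟨z, hz, rfl⟩
  change MulOpposite.op z ∈ _
  refine AddSubgroup.closure_induction (p := fun z _ => MulOpposite.op z ∈ _) ?_ ?_ ?_ ?_ hz
  · rintro _ ⟨a, ha, b, hb, rfl⟩
    exact AddSubgroup.subset_closure
      ⟨_, op_mem_opSubgroup.2 hb, _, op_mem_opSubgroup.2 ha, rfl⟩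
  · exact AddSubgroup.zero_mem _
  · exact fun _ _ _ _ => AddSubgroup.add_mem _
  · exact fun _ _ => AddSubgroup.neg_mem _

end Separation

namespace ObjectUnitalGrading

variable {G : Type*} [Category G] {S : Type*} [NonUnitalRing S] (E : ObjectUnitalGrading G S)

theorem one_mul_one (a : G) : E.one a * E.one a = E.one a :=
  E.one_mul_mem (𝟙 a) _ (E.one_mem a)

theorem one_mul_one_of_ne {a b : G} (h : a ≠ b) : E.one a * E.one b = 0 :=
  E.mul_eq_zero (𝟙 a) (𝟙 b) (E.one_mem a) (E.one_mem b) h.symm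

@[elab_as_elim]
theorem induction_on {P : S → Prop} (x : S) (hcomp : ∀ {a b : G} (g : a ⟶ b), ∀ x ∈ E.comp g, P x)
    (hzero : P 0) (hadd : ∀ x y, P x → P y → P (x + y)) : P x :=
  AddSubgroup.iSup_induction (C := P) (fun p : Σ a : G, Σ b : G, a ⟶ b => E.comp p.2.2)
    (E.span ▸ AddSubgroup.mem_top x) (fun p => hcomp p.2.2) hzero hadd

theorem one_mul_of_ne {a b c : G} (g : a ⟶ b) {x : S} (hx : x ∈ E.comp g) (h : b ≠ c) :
    E.one c * x = 0 :=
  E.mul_eq_zero (𝟙 c) g (E.one_mem c) hx h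

theorem mul_one_of_ne {a b c : G} (g : a ⟶ b) {x : S} (hx : x ∈ E.comp g) (h : a ≠ c) :
    x * E.one c = 0 :=
  E.mul_eq_zero g (𝟙 c) hx (E.one_mem c) h.symm

theorem sum_one_mul [Fintype G] (x : S) : ∑ a, E.one a * x = x := by
  refine E.induction_on x (fun {a b} g x hx => ?_) (by simp) fun x y hx hy => ?_
  · rw [Finset.sum_eq_single b (fun c _ hc => E.one_mul_of_ne g hx hc.symm) (by simp),
      E.one_mul_mem g x hx]
  · simp only [mul_add, Finset.sum_add_distrib, hx, hy]

theorem sum_mul_one [Fintype G] (x : S) : ∑ a, x * E.one a = x := by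
  refine E.induction_on x (fun {a b} g x hx => ?_) (by simp) fun x y hx hy => ?_
  · rw [Finset.sum_eq_single a (fun c _ hc => E.mul_one_of_ne g hx hc.symm) (by simp),
      E.mul_one_mem g x hx]
  · simp only [add_mul, Finset.sum_add_distrib, hx, hy]

theorem hom_eq_corner (q p : G) : E.hom q p = corner (E.one p) (E.one q) := by
  refine le_antisymm (iSup_le fun g x hx => ?_) ?_
  · exact (mem_corner_iff (E.one_mul_one p) (E.one_mul_one q)).2
      ⟨E.one_mul_mem g x hx, E.mul_one_mem g x hx⟩
  · rintro _ ⟨s, rfl⟩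
    simp only [AddMonoidHom.comp_apply, AddMonoidHom.coe_mulLeft, AddMonoidHom.coe_mulRight]
    refine E.induction_on s (fun {a b} g x hx => ?_) (by simp) fun x y hx hy => ?_
    · by_cases ha : a = q
      · by_cases hb : b = p
        · subst ha hb
          rw [E.mul_one_mem g x hx, E.one_mul_mem g x hx]
          exact AddSubgroup.mem_iSup_of_mem g hx
        · rw [← mul_assoc, E.one_mul_of_ne g hx hb, zero_mul]
          exact AddSubgroup.zero_mem _
      · rw [E.mul_one_of_ne g hx ha, mul_zero]
        exact AddSubgroup.zero_mem _
    · rw [add_mul, mul_add]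
      exact AddSubgroup.add_mem _ hx hy

theorem isStrongIdempotents {E : ObjectUnitalGrading G S} (hE : E.IsHomSetStronglyGraded) :
    IsStrongIdempotents E.one := by
  intro p q
  simpa only [hom_eq_corner] using hE p q

theorem isLeftSeparating {E : ObjectUnitalGrading G S} (hE : E.IsHomSetStronglyGraded) :
    IsLeftSeparating E.one where
  ne_zero := E.one_ne_zero
  idem := E.one_mul_one
  orthogonal _ _ := E.one_mul_one_of_ne
  sum_mul := E.sum_one_mul
  mul_sum := E.sum_mul_one
  separating p q := by
    by_cases hpq : corner (E.one p) (E.one q) = ⊥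
    · refine ⟨∅, fun y _ => (AddSubgroup.mem_bot (G := S)).1 (hpq ▸ ⟨y, ?_⟩)⟩
      simp [mul_assoc]
    · exact exists_finset_forall_mul_eq_zero (E.one_mul_one p) (E.one_mul_one q)
        (isStrongIdempotents hE q p (Or.inr hpq)).2.2

theorem isLeftSeparating_op {E : ObjectUnitalGrading G S} (hE : E.IsHomSetStronglyGraded) :
    IsLeftSeparating fun a => MulOpposite.op (E.one a) where
  ne_zero a := (MulOpposite.op_ne_zero_iff _).2 (E.one_ne_zero a)
  idem a := congrArg MulOpposite.op (E.one_mul_one a)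
  orthogonal _ _ h := congrArg MulOpposite.op (E.one_mul_one_of_ne h.symm)
  sum_mul x := MulOpposite.unop_injective (by simpa using E.sum_mul_one x.unop)
  mul_sum x := MulOpposite.unop_injective (by simpa using E.sum_one_mul x.unop)
  separating p q := by
    by_cases hqp : corner (E.one q) (E.one p) = ⊥
    · refine ⟨∅, fun y _ => MulOpposite.unop_injective ?_⟩
      refine (AddSubgroup.mem_bot (G := S)).1 (hqp ▸ ⟨y.unop, ?_⟩)
      simp
    · have hone := (isStrongIdempotents hE q p (Or.inl hqp)).2.2
      have hop := opSubgroup_sMul_le _ _ (op_mem_opSubgroup.2 hone)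
      rw [opSubgroup_corner, opSubgroup_corner] at hop
      exact exists_finset_forall_mul_eq_zero (congrArg MulOpposite.op (E.one_mul_one p))
        (congrArg MulOpposite.op (E.one_mul_one q)) hop

end ObjectUnitalGrading

theorem statement_13 {G : Type*} [Category G] (hG : HomSetStrong G)
    {S : Type*} [NonUnitalRing S] (E : ObjectUnitalGrading G S)
    (hE : E.IsHomSetStronglyGraded) :
    (IsLeftArtinian S ↔ (Finite G ∧ ∀ a : G, LeftArtinianOn (E.hom a a))) ∧
    (IsRightArtinian S ↔ (Finite G ∧ ∀ a : G, RightArtinianOn (E.hom a a))) ∧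
    (IsLeftNoetherian S ↔ (Finite G ∧ ∀ a : G, LeftNoetherianOn (E.hom a a))) ∧
    (IsRightNoetherian S ↔ (Finite G ∧ ∀ a : G, RightNoetherianOn (E.hom a a))) := by
  have hL := ObjectUnitalGrading.isLeftSeparating hE
  have hR := ObjectUnitalGrading.isLeftSeparating_op hE
  simp only [ObjectUnitalGrading.hom_eq_corner]
  refine ⟨hL.isLeftArtinian_iff, ?_, hL.isLeftNoetherian_iff, ?_⟩
  · simpa only [isLeftArtinian_op, ← opSubgroup_corner, leftArtinianOn_opSubgroup]
      using hR.isLeftArtinian_iff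
  · simpa only [isLeftNoetherian_op, ← opSubgroup_corner, leftNoetherianOn_opSubgroup]
      using hR.isLeftNoetherian_iff

end ChainPaper
end

section
/- Let G be a groupoid (a small category in which every morphism is an isomorphism) and let S be a ring that is strongly G-graded and object unital. Then S is hom-set-strongly G-graded, i.e., for all objects p,q ∈ G_0, whenever one of S_{G(p,q)} and S_{G(q,p)} is nonzero, the other is also nonzero and 1_{S_p} ∈ S_{G(p,q)} S_{G(q,p)}. -/
open CategoryTheory

namespace ChainPaper

theorem sMul_mono {S : Type*} [NonUnitalRing S] {A A' B B' : AddSubgroup S}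
    (hA : A ≤ A') (hB : B ≤ B') : sMul A B ≤ sMul A' B' :=
  AddSubgroup.closure_mono fun _ ⟨a, ha, b, hb, hx⟩ => ⟨a, hA ha, b, hB hb, hx⟩

theorem sMul_bot_left {S : Type*} [NonUnitalRing S] (B : AddSubgroup S) : sMul ⊥ B = ⊥ := by
  rw [sMul, AddSubgroup.closure_eq_bot_iff]
  rintro _ ⟨a, ha, b, -, rfl⟩
  simp [AddSubgroup.mem_bot.mp ha]

theorem sMul_bot_right {S : Type*} [NonUnitalRing S] (A : AddSubgroup S) : sMul A ⊥ = ⊥ := by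
  rw [sMul, AddSubgroup.closure_eq_bot_iff]
  rintro _ ⟨a, -, b, hb, rfl⟩
  simp [AddSubgroup.mem_bot.mp hb]

namespace ObjectUnitalGrading

theorem nonempty_of_hom_ne_bot {G : Type*} [Category G] {S : Type*} [NonUnitalRing S]
    (E : ObjectUnitalGrading G S) {a b : G} (h : E.hom a b ≠ ⊥) : Nonempty (a ⟶ b) := by
  by_contra hempty
  rw [not_nonempty_iff] at hempty
  exact h (iSup_of_empty _)

theorem IsStronglyGraded.one_mem_sMul_hom {G : Type*} [Category G] {S : Type*}
    [NonUnitalRing S] {E : ObjectUnitalGrading G S} (hE : E.IsStronglyGraded) {a b : G}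
    (g : b ⟶ a) (h : a ⟶ b) (hg : h ≫ g = 𝟙 a) :
    E.one a ∈ sMul (E.hom b a) (E.hom a b) := by
  have hmem : E.one a ∈ sMul (E.comp g) (E.comp h) := by
    rw [hE g h, hg]
    exact E.one_mem a
  exact sMul_mono (le_iSup (fun k : b ⟶ a => E.comp k) g)
    (le_iSup (fun k : a ⟶ b => E.comp k) h) hmem

end ObjectUnitalGrading

theorem statement_14 {G : Type*} [Groupoid G] {S : Type*} [NonUnitalRing S]
    (E : ObjectUnitalGrading G S) (hE : E.IsStronglyGraded) :
    E.IsHomSetStronglyGraded := by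
  intro p q hpq
  have hiso : Nonempty (q ⟶ p) := hpq.elim E.nonempty_of_hom_ne_bot
    fun h => (E.nonempty_of_hom_ne_bot h).map Groupoid.inv
  obtain ⟨g⟩ := hiso
  have hone := hE.one_mem_sMul_hom g (Groupoid.inv g) (Groupoid.inv_comp g)
  refine ⟨fun h => ?_, fun h => ?_, hone⟩
  · rw [h, sMul_bot_left] at hone
    exact E.one_ne_zero p hone
  · rw [h, sMul_bot_right] at hone
    exact E.one_ne_zero p hone

end ChainPaper
end
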